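/- arXiv:2106.00951 — 2 statements merged into one kernel-verified Lean document; each statement's English description precedes it below -/
import Mathlib

section
/- Let g*_1, …, g*_r ∈ ℝ^d be unit vectors and p_1, …, p_r ∈ ℝ^d, and suppose the matrix M = Σ_{j=1}^r P_{g*_j} is positive definite (hence invertible). If q ∈ ℝ^d satisfies P_{g*_j}(q − p_j) = 0 for every j ∈ {1, …, r}, then q = M^{-1} (Σ_{j=1}^r P_{g*_j} p_j); in particular, there is at most one point q satisfying all these bearing constraints. -/
open Matrix

/-- Projection matrix `P_x = I - x xᵀ / ‖x‖²` (with `‖x‖² = x ⬝ᵥ x`). -/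
noncomputable def projM {d : ℕ} (x : Fin d → ℝ) : Matrix (Fin d) (Fin d) ℝ :=
  1 - (x ⬝ᵥ x)⁻¹ • Matrix.vecMulVec x x

/-- if `M = Σ_j P_{g*_j}` is positive definite and `q` satisfies all
the bearing constraints `P_{g*_j}(q − p_j) = 0`, then
`q = M⁻¹ (Σ_j P_{g*_j} p_j)`; in particular such a point is unique. -/
theorem stmt5 {d r : ℕ} (gstar : Fin r → (Fin d → ℝ))
    (hgstar : ∀ j, gstar j ⬝ᵥ gstar j = 1)
    (p : Fin r → (Fin d → ℝ))
    (M : Matrix (Fin d) (Fin d) ℝ) (hM : M = ∑ j, projM (gstar j))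
    (hMpd : M.PosDef)
    (q : Fin d → ℝ) (hq : ∀ j, (projM (gstar j)).mulVec (q - p j) = 0) :
    q = M⁻¹.mulVec (∑ j, (projM (gstar j)).mulVec (p j)) := by
  have h : ∑ j, (projM (gstar j)).mulVec (p j) = M.mulVec q := by
    rw [hM, Matrix.sum_mulVec]
    refine Finset.sum_congr rfl fun j _ => ?_
    have h1 := hq j
    rw [Matrix.mulVec_sub] at h1
    exact (sub_eq_zero.mp h1).symm
  have hu : IsUnit M.det := (Matrix.isUnit_iff_isUnit_det M).mp hMpd.isUnit
  rw [h, Matrix.mulVec_mulVec, Matrix.nonsing_inv_mul M hu, Matrix.one_mulVec]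
end

section
/- Let a, b > 0, 0 < β₁ < 1 < β₂, t₀ ∈ ℝ, and let V : [t₀, ∞) → ℝ be differentiable with V(t) ≥ 0 and V'(t) ≤ −a V(t)^{β₁} − b V(t)^{β₂} for all t ≥ t₀. Then V(t) = 0 for all t ≥ t₀ + 1/(a(1−β₁)) + 1/(b(β₂−1)); in particular the settling time is bounded independently of the initial value V(t₀). -/
theorem mvt_le_aux {f f' : ℝ → ℝ} {x y C : ℝ} (hxy : x ≤ y)
    (hf : ∀ s ∈ Set.Icc x y, HasDerivAt f (f' s) s)
    (hC : ∀ s ∈ Set.Icc x y, f' s ≤ C) : f y - f x ≤ C * (y - x) := by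
  rcases hxy.eq_or_lt with h | h
  · subst h; simp
  · obtain ⟨c, hc, h2⟩ := exists_hasDerivAt_eq_slope f f' h
      (fun s hs => (hf s hs).continuousAt.continuousWithinAt)
      (fun s hs => hf s (Set.Ioo_subset_Icc_self hs))
    have h3 := hC c (Set.Ioo_subset_Icc_self hc)
    rw [h2, div_le_iff₀ (by linarith)] at h3
    exact h3


/-- fixed-time stability comparison lemma of Polyakov:
if `V ≥ 0` and `V' ≤ −a V^{β₁} − b V^{β₂}` with `a, b > 0` and
`0 < β₁ < 1 < β₂`, then `V` vanishes from time
`t₀ + 1/(a(1−β₁)) + 1/(b(β₂−1))` on, a bound independent of `V(t₀)`. -/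
theorem stmt15 {a b b1 b2 t0 : ℝ} (ha : 0 < a) (hb : 0 < b)
    (hb1 : 0 < b1) (hb1' : b1 < 1) (hb2 : 1 < b2)
    (V V' : ℝ → ℝ)
    (hVnonneg : ∀ t ≥ t0, 0 ≤ V t)
    (hVderiv : ∀ t ≥ t0, HasDerivAt V (V' t) t)
    (hineq : ∀ t ≥ t0, V' t ≤ -a * (V t) ^ b1 - b * (V t) ^ b2) :
    ∀ t ≥ t0 + 1 / (a * (1 - b1)) + 1 / (b * (b2 - 1)), V t = 0 := by
  intro t ht
  have hA : 0 < a * (1 - b1) := mul_pos ha (by linarith)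
  have hB : 0 < b * (b2 - 1) := mul_pos hb (by linarith)
  have hA' := one_div_pos.mpr hA
  have hB' := one_div_pos.mpr hB
  by_contra hne
  have htt : t0 ≤ t := by linarith
  have htpos : 0 < V t := lt_of_le_of_ne (hVnonneg t htt) (Ne.symm hne)
  have hpos : ∀ s, t0 ≤ s → s ≤ t → 0 < V s := by
    intro s hs hst
    have := mvt_le_aux (C := 0) hst (fun u hu => hVderiv u (hs.trans hu.1)) (by
      intro u hu
      have h1 := hineq u (hs.trans hu.1)
      have h0 := hVnonneg u (hs.trans hu.1)
      have h2 := mul_nonneg ha.le (Real.rpow_nonneg h0 b1)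
      have h3 := mul_nonneg hb.le (Real.rpow_nonneg h0 b2)
      linarith)
    linarith
  have hder : ∀ p s, t0 ≤ s → s ≤ t →
      HasDerivAt (fun s => (V s) ^ p) (V' s * p * (V s) ^ (p - 1)) s := fun p s hs hst =>
    (hVderiv s hs).rpow_const (Or.inl (hpos s hs hst).ne')
  obtain ⟨s1, hs1⟩ : ∃ s1, s1 = t0 + 1 / (b * (b2 - 1)) := ⟨_, rfl⟩
  have h01 : t0 ≤ s1 := by linarith
  have h1t : s1 ≤ t := by linarith
  have key : ∀ s, t0 ≤ s → s ≤ t → V' s * (V s) ^ (-b1) ≤ -a ∧ V' s * (V s) ^ (-b2) ≤ -b := by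
    intro s hs hst
    have hp := hpos s hs hst
    have hi := hineq s hs
    have e1 := Real.rpow_pos_of_pos hp b1
    have e2 := Real.rpow_pos_of_pos hp b2
    have m1 := mul_pos ha e1
    have m2 := mul_pos hb e2
    rw [Real.rpow_neg hp.le, Real.rpow_neg hp.le, ← div_eq_mul_inv, ← div_eq_mul_inv,
      div_le_iff₀ e1, div_le_iff₀ e2]
    constructor <;> linarith
  -- first phase
  have P1 := mvt_le_aux (f := fun s => -(V s) ^ (1 - b2)) (C := -(b * (b2 - 1))) h01
    (fun s hs => (hder (1 - b2) s hs.1 (hs.2.trans h1t)).neg) (by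
      intro s hs
      have k := (key s hs.1 (hs.2.trans h1t)).2
      have e : 1 - b2 - 1 = -b2 := by ring
      rw [e]
      nlinarith [mul_le_mul_of_nonneg_left k (by linarith : 0 ≤ b2 - 1)])
  have E1 : b * (b2 - 1) * (s1 - t0) = 1 := by
    rw [hs1, add_sub_cancel_left, mul_one_div, div_self hB.ne']
  have q0 := Real.rpow_pos_of_pos (hpos t0 le_rfl htt) (1 - b2)
  have hV1 : V s1 < 1 := by
    by_contra hcon
    have := Real.rpow_le_one_of_one_le_of_nonpos (not_lt.mp hcon) (by linarith : 1 - b2 ≤ 0)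
    linarith
  -- second phase
  have P2 := mvt_le_aux (f := fun s => (V s) ^ (1 - b1)) (C := -(a * (1 - b1))) h1t
    (fun s hs => hder (1 - b1) s (h01.trans hs.1) hs.2) (by
      intro s hs
      have k := (key s (h01.trans hs.1) hs.2).1
      have e : 1 - b1 - 1 = -b1 := by ring
      rw [e]
      nlinarith [mul_le_mul_of_nonneg_left k (by linarith : 0 ≤ 1 - b1)])
  have E2 : 1 ≤ a * (1 - b1) * (t - s1) := by
    have : 1 / (a * (1 - b1)) ≤ t - s1 := by linarith
    rw [div_le_iff₀ hA] at this
    linarith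
  have r1 := Real.rpow_lt_one (hpos s1 h01 h1t).le hV1 (by linarith : 0 < 1 - b1)
  have r2 := Real.rpow_pos_of_pos htpos (1 - b1)
  linarith
end
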